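/- Let F be an algebraically closed field of characteristic 0 and let g be the simple Lie algebra of type G2 over F (equivalently, a finite-dimensional simple Lie algebra over F with dim g = 14). Then there exists a grading of g by the group (ℤ/2ℤ)^3 such that dim g_α = 2 for every nonzero α ∈ (ℤ/2ℤ)^3 (so necessarily g_0 = 0), and any two such gradings of g are equivalent. -/

import Mathlib

open Module

/-- A grading of the Lie algebra `L` over `F` by the additive group `A`:
a direct sum decomposition into subspaces compatible with the bracket. -/
def IsLieGrading (F : Type*) {A L : Type*} [Field F] [AddCommGroup A] [DecidableEq A]
    [LieRing L] [LieAlgebra F L] (gr : A → Submodule F L) : Prop :=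
  DirectSum.IsInternal gr ∧
    ∀ a b : A, ∀ x ∈ gr a, ∀ y ∈ gr b, ⁅x, y⁆ ∈ gr (a + b)

/-- Two gradings of `L` are equivalent if some automorphism of `L` maps each nonzero
homogeneous component of the first grading onto a homogeneous component of the second. -/
def GradingsEquiv (F : Type*) {A B L : Type*} [Field F] [AddCommGroup A] [AddCommGroup B]
    [LieRing L] [LieAlgebra F L] (gr : A → Submodule F L) (gr' : B → Submodule F L) : Prop :=
  ∃ φ : L ≃ₗ⁅F⁆ L, ∀ a : A, gr a ≠ ⊥ →
    ∃ b : B, (gr a).map φ.toLinearEquiv.toLinearMap = gr' b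

namespace LieAlgebra.Basis

theorem trans_symm_apply_of_mem {K L₁ L₂ : Type*} [Field K] [LieRing L₁] [LieAlgebra K L₁]
    [LieRing L₂] [LieAlgebra K L₂] (D : LieSubalgebra K (L₁ × L₂))
    (P : D ≃ₗ⁅K⁆ L₁) (Q : D ≃ₗ⁅K⁆ L₂) (hP : ∀ y, P y = (y : L₁ × L₂).1)
    (hQ : ∀ y, Q y = (y : L₁ × L₂).2) {x : L₁} {x' : L₂} (h : (x, x') ∈ D) :
    (P.symm.trans Q) x = x' := by
  have : P.symm x = ⟨(x, x'), h⟩ :=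
    P.injective ((LieEquiv.apply_symm_apply _ _).trans (hP ⟨(x, x'), h⟩).symm)
  rw [LieEquiv.trans_apply, this, hQ]

variable {ι K L : Type*} [Finite ι] [Field K] [CharZero K] [LieRing L] [LieAlgebra K L]
  [FiniteDimensional K L]

/-- The isomorphism theorem: bases of a simple Lie algebra with equal Cartan matrices are conjugate
under an automorphism. -/
theorem exists_lieEquiv [LieAlgebra.IsSimple K L] {H₁ H₂ : LieSubalgebra K L}
    (b₁ : LieAlgebra.Basis ι H₁) (b₂ : LieAlgebra.Basis ι H₂) (hA : b₁.A = b₂.A) :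
    ∃ φ : L ≃ₗ⁅K⁆ L, (∀ i, φ (b₁.e i) = b₂.e i) ∧ (∀ i, φ (b₁.f i) = b₂.f i) ∧
      (∀ i, φ (b₁.h i) = b₂.h i) := by
  have hA' : b₁.A.reindex (Equiv.refl ι) (Equiv.refl ι) = b₂.A := by simpa using hA
  have hE : ∀ i, equivOfReindex (Equiv.refl ι) b₁ b₂ hA' (b₁.e i) = b₂.e i := by
    intro i
    unfold equivOfReindex
    refine trans_symm_apply_of_mem _ _ _ (fun _ ↦ rfl) (fun _ ↦ rfl) ?_
    exact LieSubalgebra.subset_lieSpan (Or.inl (Or.inr ⟨i, rfl⟩))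
  have hF : ∀ i, equivOfReindex (Equiv.refl ι) b₁ b₂ hA' (b₁.f i) = b₂.f i := by
    intro i
    unfold equivOfReindex
    refine trans_symm_apply_of_mem _ _ _ (fun _ ↦ rfl) (fun _ ↦ rfl) ?_
    exact LieSubalgebra.subset_lieSpan (Or.inr ⟨i, rfl⟩)
  refine ⟨_, hE, hF, fun i ↦ ?_⟩
  rw [← (b₁.sl2 i).lie_e_f, ← (b₂.sl2 i).lie_e_f, LieEquiv.map_lie, hE, hF]

end LieAlgebra.Basis

namespace RootPairing

variable {ι R M N : Type*} [Finite ι] [Field R] [CharZero R] [AddCommGroup M] [Module R M]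
  [AddCommGroup N] [Module R N] {P : RootPairing ι R M N}

omit [Finite ι] in
theorem pairingIn_of_root_eq [P.IsCrystallographic] {i j k : ι} {m n : ℤ}
    (h : P.root k = m • P.root i + n • P.root j) (l : ι) :
    P.pairingIn ℤ k l = m * P.pairingIn ℤ i l + n * P.pairingIn ℤ j l := by
  have := congrArg (P.coroot' l) h
  simp only [map_add, map_zsmul, root_coroot'_eq_pairing] at this
  apply FaithfulSMul.algebraMap_injective ℤ R
  simp only [map_add, map_mul, algebraMap_pairingIn]
  simpa using this

omit [Finite ι] in
theorem pairingIn_reflectionPerm_eq [P.IsCrystallographic] (i k l : ι) :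
    P.pairingIn ℤ (P.reflectionPerm i k) l =
      P.pairingIn ℤ k l - P.pairingIn ℤ k i * P.pairingIn ℤ i l := by
  have h : P.root (P.reflectionPerm i k) =
      (1 : ℤ) • P.root k + (-P.pairingIn ℤ k i) • P.root i := by
    rw [root_reflectionPerm, reflection_apply_root, ← P.algebraMap_pairingIn ℤ k i]
    simp [sub_eq_add_neg, ← Int.cast_smul_eq_zsmul R]
  rw [pairingIn_of_root_eq h]; ring

namespace Base

variable [P.IsCrystallographic] [P.IsReduced] (b : P.Base)

omit [P.IsCrystallographic] [P.IsReduced] in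
theorem card_eq_two_mul_card_pos :
    Nat.card ι = 2 * Nat.card {k : ι // 0 < b.height k} := by
  classical
  let := Fintype.ofFinite ι
  let := P.indexNeg
  have e : {k : ι // 0 < b.height k} ≃ {k : ι // ¬ 0 < b.height k} :=
    { toFun k := ⟨-k, by rw [height_reflectionPerm_self]; have := k.2; omega⟩
      invFun k := ⟨-k, by
        rw [height_reflectionPerm_self]; have := k.2; have := b.height_ne_zero k.1; omega⟩
      left_inv k := Subtype.ext (neg_neg _)
      right_inv k := Subtype.ext (neg_neg _) }
  rw [← Nat.card_congr (Equiv.sumCompl fun k : ι ↦ 0 < b.height k), Nat.card_sum,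
    ← Nat.card_congr e]
  ring

theorem exists_ne_zero_cartanMatrix [P.IsIrreducible] (h : 2 ≤ b.support.card) (i : b.support) :
    ∃ j : b.support, j ≠ i ∧ b.cartanMatrix j i ≠ 0 := by
  by_contra! hc
  obtain ⟨j, hj⟩ : ∃ j : b.support, j ≠ i := by
    have : Nontrivial b.support := by
      rw [← Fintype.one_lt_card_iff_nontrivial]; simp; omega
    exact exists_ne i
  refine hj (b.induction_on_cartanMatrix (fun k ↦ k = i) rfl ?_ (j := j))
  intro k l hk hl
  subst hk
  by_contra hne
  exact hl (hc l hne)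

omit [P.IsCrystallographic] [P.IsReduced] in
theorem card_support_le : b.support.card ≤ Nat.card {k : ι // 0 < b.height k} := by
  rw [← Nat.card_eq_finsetCard]
  refine Nat.card_le_card_of_injective (fun k : b.support ↦
    (⟨k, by rw [height_one_of_mem_support k.2]; exact one_pos⟩ : {k : ι // 0 < b.height k})) ?_
  exact fun k l h ↦ Subtype.ext (congrArg (fun x ↦ x.1) h)

theorem card_pos_le_four [P.IsNotG2] (h : b.support.card = 2) :
    Nat.card {k : ι // 0 < b.height k} ≤ 4 := by
  classical
  obtain ⟨i, j, hij, hs⟩ := Finset.card_eq_two.mp h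
  have hi : i ∈ b.support := by simp [hs]
  have hj : j ∈ b.support := by simp [hs]
  have key : ∀ k, 0 < b.height k → ∃ m n : ℤ, 0 ≤ m ∧ 0 ≤ n ∧
      P.root k = m • P.root i + n • P.root j := by
    intro k hk
    obtain ⟨f, -, hf, hr⟩ := b.exists_root_eq_sum_int k
    have hh := height_eq_sum hr
    rw [hs, Finset.sum_pair hij] at hr hh
    rcases hf with hf | hf
    · exact ⟨f i, f j, hf.le i, hf.le j, hr⟩
    · have := hf.le i
      have := hf.le j
      simp only [Pi.zero_apply] at *
      omega
  choose! m n hm hn hr using key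
  have h2 : ∀ k l, -2 ≤ P.pairingIn ℤ k l ∧ P.pairingIn ℤ k l ≤ 2 := by
    intro k l
    have := IsNotG2.pairingIn_mem_zero_one_two (P := P) k l
    simp only [Set.mem_insert_iff, Set.mem_singleton_iff] at this
    omega
  have hle := b.pairingIn_le_zero_of_ne hij hi hj
  have hle' := b.pairingIn_le_zero_of_ne hij.symm hj hi
  have hmem := P.pairingIn_pairingIn_mem_set_of_isCrystal_of_isRed' i j
    (fun h ↦ hij (P.root.injective h)) (b.root_ne_neg_of_ne hi hj hij)
  simp only [Set.mem_insert_iff, Set.mem_singleton_iff, Prod.mk.injEq] at hmem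
  have hii : P.pairingIn ℤ i i = 2 := P.pairingIn_same ℤ i
  have hjj : P.pairingIn ℤ j j = 2 := P.pairingIn_same ℤ j
  have hinj : Set.InjOn (fun k ↦ (m k, n k)) {k | 0 < b.height k} := by
    intro k hk l hl hkl
    simp only [Prod.mk.injEq] at hkl
    apply P.root.injective
    rw [hr k hk, hr l hl, hkl.1, hkl.2]
  set c := P.pairingIn ℤ i j
  set d := P.pairingIn ℤ j i
  have hb : ∀ k, 0 < b.height k →
      (m k ≠ 0 ∨ n k ≠ 0) ∧
      (-2 ≤ 2 * m k + n k * d ∧ 2 * m k + n k * d ≤ 2) ∧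
      (-2 ≤ m k * c + 2 * n k ∧ m k * c + 2 * n k ≤ 2) ∧
      (-2 ≤ m k * c + 2 * n k - (2 * m k + n k * d) * c ∧
        m k * c + 2 * n k - (2 * m k + n k * d) * c ≤ 2) ∧
      (-2 ≤ 2 * m k + n k * d - (m k * c + 2 * n k) * d ∧
        2 * m k + n k * d - (m k * c + 2 * n k) * d ≤ 2) := by
    intro k hk
    have e1 : P.pairingIn ℤ k i = 2 * m k + n k * d := by
      rw [pairingIn_of_root_eq (hr k hk) i, hii]; ring
    have e2 : P.pairingIn ℤ k j = m k * c + 2 * n k := by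
      rw [pairingIn_of_root_eq (hr k hk) j, hjj]; ring
    have e3 := pairingIn_reflectionPerm_eq (P := P) i k j
    have e4 := pairingIn_reflectionPerm_eq (P := P) j k i
    rw [e1, e2] at e3 e4
    refine ⟨?_, e1 ▸ h2 k i, e2 ▸ h2 k j, e3 ▸ h2 _ _, e4 ▸ h2 _ _⟩
    by_contra! h0
    exact P.ne_zero k (by rw [hr k hk, h0.1, h0.2]; simp)
  have hc : -2 ≤ c ∧ c ≤ 2 := h2 i j
  have hd : -2 ≤ d ∧ d ≤ 2 := h2 j i
  clear_value c d
  let T : Finset (ℤ × ℤ) :=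
    if c = 0 then {(1, 0), (0, 1), (1, 1)} else if c = -1 ∧ d = -1 then
      {(1, 0), (0, 1), (1, 1), (2, 2)} else if c = -1 ∧ d = -2 then
      {(1, 0), (0, 1), (1, 1), (2, 1)} else {(1, 0), (0, 1), (1, 1), (1, 2)}
  have hT : T.card ≤ 4 := by
    simp only [T]; split_ifs <;> decide
  have hmaps : ∀ k ∈ {k | 0 < b.height k}, (m k, n k) ∈ T := by
    intro k hk
    have h1 := hb k hk
    have h3 := hm k hk
    have h4 := hn k hk
    simp only [T]
    generalize m k = x at h1 h3 ⊢
    generalize n k = y at h1 h4 ⊢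
    have hcd : (c = 0 ∧ d = 0) ∨ (c = -1 ∧ d = -1) ∨ (c = -1 ∧ d = -2) ∨ (c = -2 ∧ d = -1) := by
      omega
    rcases hcd with ⟨h5, h6⟩ | ⟨h5, h6⟩ | ⟨h5, h6⟩ | ⟨h5, h6⟩ <;> subst h5 h6 <;>
    · have hx : x ≤ 4 := by omega
      have hy : y ≤ 4 := by omega
      interval_cases x <;> interval_cases y <;> revert h1 <;> decide
  refine le_trans ?_ hT
  rw [← Nat.card_eq_finsetCard T]
  refine Nat.card_le_card_of_injective (fun k : {k : ι // 0 < b.height k} ↦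
    (⟨_, hmaps k.1 k.2⟩ : T)) ?_
  intro k l hkl
  exact Subtype.ext (hinj k.2 l.2 (by simpa [Subtype.ext_iff] using hkl))

theorem card_support_add_two_le [P.IsRootSystem] [P.IsIrreducible] (h : 4 ≤ b.support.card) :
    b.support.card + 2 ≤ Nat.card {k : ι // 0 < b.height k} := by
  classical
  obtain ⟨i⟩ : Nonempty b.support :=
    (Finset.card_pos.mp (by omega)).to_subtype
  obtain ⟨j, hji, hj⟩ := b.exists_ne_zero_cartanMatrix (by omega) i
  obtain ⟨k, hk⟩ : ∃ k : b.support, k ∉ ({i, j} : Finset b.support) := by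
    by_contra! hc
    have h1 : (Finset.univ : Finset b.support).card ≤ ({i, j} : Finset b.support).card :=
      Finset.card_le_card fun x _ ↦ hc x
    have h2 := Finset.card_le_two (a := i) (b := j)
    simp at h1
    omega
  simp only [Finset.mem_insert, Finset.mem_singleton, not_or] at hk
  obtain ⟨l, hlk, hl⟩ := b.exists_ne_zero_cartanMatrix (by omega) k
  obtain ⟨x, hx⟩ := not_not.mp (mt (b.cartanMatrix_apply_eq_zero_iff hji).mpr hj)
  obtain ⟨y, hy⟩ := not_not.mp (mt (b.cartanMatrix_apply_eq_zero_iff hlk).mpr hl)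
  have hx2 : b.height x = 2 := by
    rw [b.height_add hx, height_one_of_mem_support i.2, height_one_of_mem_support j.2]; rfl
  have hy2 : b.height y = 2 := by
    rw [b.height_add hy, height_one_of_mem_support k.2, height_one_of_mem_support l.2]; rfl
  have hxy : x ≠ y := by
    rintro rfl
    have h0 := congrArg (b.toWeightBasis.repr · k) (hx.symm.trans hy)
    have hjk : j ≠ k := Ne.symm hk.2
    have hik : i ≠ k := Ne.symm hk.1
    simp [hjk, hik, hlk] at h0
  have hsub : ∀ z ∈ insert x (insert y b.support), 0 < b.height z := by
    intro z hz
    simp only [Finset.mem_insert] at hz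
    rcases hz with rfl | rfl | hz
    · omega
    · omega
    · rw [height_one_of_mem_support hz]; exact one_pos
  have hy' : y ∉ b.support := fun h ↦ by
    have := height_one_of_mem_support h; omega
  have hx' : x ∉ insert y b.support := fun h ↦ by
    rcases Finset.mem_insert.mp h with h | h
    · exact hxy h
    · have := height_one_of_mem_support h; omega
  have hcard : (insert x (insert y b.support)).card = b.support.card + 2 := by
    rw [Finset.card_insert_of_notMem hx', Finset.card_insert_of_notMem hy']
  rw [← hcard, ← Nat.card_eq_finsetCard]
  refine Nat.card_le_card_of_injective (fun k : (insert x (insert y b.support) : Finset ι) ↦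
    (⟨k, hsub _ k.2⟩ : {k : ι // 0 < b.height k})) ?_
  exact fun k l h ↦ Subtype.ext (congrArg (fun x ↦ x.1) h)

/-- A root system of rank `r` with `14 - r` roots is of type `𝔤₂`. -/
theorem isG2_of_card_add_card [P.IsRootSystem] [P.IsIrreducible]
    (h : b.support.card + Nat.card ι = 14) :
    P.IsG2 := by
  by_contra hG
  rw [not_isG2_iff_isNotG2] at hG
  have h1 := b.card_eq_two_mul_card_pos
  have h2 := b.card_support_le
  by_cases h4 : 4 ≤ b.support.card
  · have := b.card_support_add_two_le h4
    omega
  · by_cases h3 : b.support.card = 2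
    · have := b.card_pos_le_four h3
      omega
    · have h0 : b.support.card = 0 := by omega
      have : Nonempty ι := by
        rw [← Finite.card_pos_iff]; omega
      have := b.support_nonempty
      rw [Finset.card_eq_zero] at h0
      simp [h0] at this

end Base
end RootPairing

namespace LieAlgebra.IsKilling

variable {K L : Type*} [Field K] [CharZero K] [LieRing L] [LieAlgebra K L] [FiniteDimensional K L]
  [IsKilling K L] (H : LieSubalgebra K L) [H.IsCartanSubalgebra]
  [LieModule.IsTriangularizable K H L]

theorem finrank_eq_finrank_cartan_add_card_root [Nontrivial L] :
    finrank K L = finrank K H + H.root.card := by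
  classical
  have hinternal : DirectSum.IsInternal fun χ : LieModule.Weight K H L ↦
      (LieModule.genWeightSpace L χ).toSubmodule := by
    rw [DirectSum.isInternal_submodule_iff_iSupIndep_and_iSup_eq_top]
    refine ⟨?_, ?_⟩
    · exact LieSubmodule.iSupIndep_toSubmodule.mpr (LieModule.iSupIndep_genWeightSpace' K H L)
    · rw [← LieSubmodule.iSup_toSubmodule, LieModule.iSup_genWeightSpace_eq_top' K H L]
      rfl
  have h1 := (LinearEquiv.ofBijective (DirectSum.coeLinearMap _) hinternal).finrank_eq
  rw [finrank_directSum, ← Finset.sum_filter_add_sum_filter_not _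
    (fun χ : LieModule.Weight K H L ↦ χ.IsNonZero)] at h1
  rw [← h1, add_comm]
  congr 1
  · rw [Finset.sum_eq_single 0]
    · rw [FunLike.coe_zero]
      exact congrArg (fun S : Submodule K L ↦ finrank K S)
        (congrArg LieSubmodule.toSubmodule (LieAlgebra.rootSpace_zero_eq K L H))
    · intro χ hχ h0
      simp [LieModule.Weight.isZero_iff_eq_zero, h0, LieModule.Weight.IsNonZero] at hχ
    · simp [LieModule.Weight.IsNonZero, LieModule.Weight.isZero_iff_eq_zero]
  · rw [Finset.card_eq_sum_ones]
    refine Finset.sum_congr rfl fun χ hχ ↦ ?_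
    exact finrank_rootSpace_eq_one χ (by simpa using hχ)

theorem isG2_rootSystem [LieAlgebra.IsSimple K L] (h : finrank K L = 14) :
    (rootSystem H).IsG2 := by
  have := LieAlgebra.IsSimple.nontrivial K L
  obtain ⟨b⟩ := (rootSystem H).nonempty_base
  refine b.isG2_of_card_add_card ?_
  have h1 := finrank_eq_finrank_cartan_add_card_root H
  have h2 := Module.finrank_eq_card_basis b.toWeightBasis
  rw [Subspace.dual_finrank_eq] at h2
  simp at h2
  rw [← h2, Nat.card_eq_finsetCard, ← h1, h]

end LieAlgebra.IsKilling

namespace LieAlgebra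

/-- The Cartan matrix of type `G₂`, with entries `⟨αᵢ, αⱼ^∨⟩` where `α₀` is the short root. -/
def matrixG2 : Matrix (Fin 2) (Fin 2) ℤ := !![2, -1; -3, 2]

/-- Families of elements of a Lie algebra satisfying the Chevalley relations of type `G₂`. -/
structure IsG2Family (K : Type*) {L : Type*} [Field K] [LieRing L] [LieAlgebra K L]
    (h e f : Fin 2 → L) : Prop where
  linInd : LinearIndependent K h
  sl2 : ∀ i, IsSl2Triple (h i) (e i) (f i)
  lie_h_h : ∀ i j, ⁅h i, h j⁆ = 0
  lie_h_e : ∀ i j, ⁅h j, e i⁆ = matrixG2 i j • e i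
  lie_h_f : ∀ i j, ⁅h j, f i⁆ = -matrixG2 i j • f i
  lie_e_f_ne : ∀ i j, i ≠ j → ⁅e i, f j⁆ = 0

/-- The iterated brackets of the two raising (or lowering) generators spanning the six positive
(or negative) root spaces of a Lie algebra of type `G₂`. -/
def wordG2 {L : Type*} [LieRing L] (e : Fin 2 → L) : Fin 6 → L :=
  ![e 0, e 1, ⁅e 0, e 1⁆, ⁅e 0, ⁅e 0, e 1⁆⁆, ⁅e 0, ⁅e 0, ⁅e 0, e 1⁆⁆⁆,
    ⁅e 1, ⁅e 0, ⁅e 0, ⁅e 0, e 1⁆⁆⁆⁆]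

/-- The values of the six positive roots of `G₂` on an auxiliary regular element. -/
def valueG2 : Fin 6 → ℤ := ![1, 5, 6, 7, 8, 13]

section

variable {K L : Type*} [Field K] [LieRing L] [LieAlgebra K L]

theorem lie_lie_eq_smul {t x y : L} {a b : ℤ} (hx : ⁅t, x⁆ = a • x) (hy : ⁅t, y⁆ = b • y) :
    ⁅t, ⁅x, y⁆⁆ = (a + b) • ⁅x, y⁆ := by
  rw [leibniz_lie, hx, hy, smul_lie, lie_smul, add_smul]

theorem lie_wordG2 {t : L} {e : Fin 2 → L} {a b : ℤ} (h0 : ⁅t, e 0⁆ = a • e 0)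
    (h1 : ⁅t, e 1⁆ = b • e 1) (k : Fin 6) :
    ⁅t, wordG2 e k⁆ =
      (![a, b, a + b, a + (a + b), a + (a + (a + b)), b + (a + (a + (a + b)))] : Fin 6 → ℤ) k •
        wordG2 e k := by
  have h2 := lie_lie_eq_smul h0 h1
  have h3 := lie_lie_eq_smul h0 h2
  have h4 := lie_lie_eq_smul h0 h3
  have h5 := lie_lie_eq_smul h1 h4
  fin_cases k <;> assumption

end

namespace IsG2Family

variable {K L : Type*} [Field K] [CharZero K] [LieRing L] [LieAlgebra K L] {h e f : Fin 2 → L}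

section

variable (g : IsG2Family K h e f)
include g

omit [CharZero K] in
theorem symm : IsG2Family K (fun i ↦ -h i) f e where
  linInd := by
    have := g.linInd.units_smul (fun _ ↦ -1)
    convert this using 1
    ext i; simp
  sl2 i := (g.sl2 i).symm
  lie_h_h i j := by simp [g.lie_h_h]
  lie_h_e i j := by simp [g.lie_h_f]
  lie_h_f i j := by simp [g.lie_h_e]
  lie_e_f_ne i j hij := by rw [← lie_skew, g.lie_e_f_ne j i hij.symm, neg_zero]

theorem wordG2_ne_zero [FiniteDimensional K L] (k : Fin 6) : wordG2 e k ≠ 0 := by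
  have h01 : ⁅h 0, e 1⁆ = (-3 : ℤ) • e 1 := by simpa [matrixG2] using g.lie_h_e 1 0
  have h10 : ⁅h 1, e 0⁆ = (-1 : ℤ) • e 0 := by simpa [matrixG2] using g.lie_h_e 0 1
  have h11 : ⁅h 1, e 1⁆ = (2 : ℤ) • e 1 := by simpa [matrixG2] using g.lie_h_e 1 1
  have hf01 : ⁅f 0, e 1⁆ = 0 := by rw [← lie_skew, g.lie_e_f_ne 1 0 (by decide), neg_zero]
  have hf10 : ⁅f 1, e 0⁆ = 0 := by rw [← lie_skew, g.lie_e_f_ne 0 1 (by decide), neg_zero]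
  have hP : (g.sl2 0).symm.HasPrimitiveVectorWith (e 1) ((3 : ℕ) : K) :=
    { ne_zero := (g.sl2 1).e_ne_zero
      lie_h := by rw [neg_lie, h01, ← Int.cast_smul_eq_zsmul K]; simp
      lie_e := hf01 }
  have h3 := hP.pow_toEnd_f_ne_zero_of_eq_nat rfl (i := 3) le_rfl
  have h3' : ⁅e 0, ⁅e 0, ⁅e 0, e 1⁆⁆⁆ ≠ 0 := by simpa [pow_succ] using h3
  have hw : ⁅h 1, ⁅e 0, ⁅e 0, ⁅e 0, e 1⁆⁆⁆⁆ = (-1 : ℤ) • ⁅e 0, ⁅e 0, ⁅e 0, e 1⁆⁆⁆ :=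
    lie_lie_eq_smul h10 (lie_lie_eq_smul h10 (lie_lie_eq_smul h10 h11))
  have hl : ⁅f 1, ⁅e 0, ⁅e 0, ⁅e 0, e 1⁆⁆⁆⁆ = 0 := by
    have : ⁅f 1, e 1⁆ = - h 1 := by rw [← lie_skew, (g.sl2 1).lie_e_f]
    have h10' : ⁅e 0, h 1⁆ = e 0 := by rw [← lie_skew, h10]; simp
    simp [leibniz_lie (f 1), hf10, this, h10']
  have hQ : (g.sl2 1).symm.HasPrimitiveVectorWith _ ((1 : ℕ) : K) :=
    { ne_zero := h3'
      lie_h := by rw [neg_lie, hw, neg_smul, one_smul, neg_neg, Nat.cast_one, one_smul]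
      lie_e := hl }
  have h5 := hQ.pow_toEnd_f_ne_zero_of_eq_nat rfl (i := 1) le_rfl
  have h5' : ⁅e 1, ⁅e 0, ⁅e 0, ⁅e 0, e 1⁆⁆⁆⁆ ≠ 0 := by simpa using h5
  fin_cases k
  · exact (g.sl2 0).e_ne_zero
  · exact (g.sl2 1).e_ne_zero
  · exact fun h0 : ⁅e 0, e 1⁆ = 0 ↦ h3' (by simp [h0])
  · exact fun h0 : ⁅e 0, ⁅e 0, e 1⁆⁆ = 0 ↦ h3' (by simp [h0])
  · exact h3'
  · exact h5'


end
end IsG2Family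
end LieAlgebra

namespace LieAlgebra

/-- A regular element of the Cartan subalgebra, whose eigenvalues separate the roots. -/
def regularG2 {L : Type*} [LieRing L] (h : Fin 2 → L) : L := (7 : ℤ) • h 0 + (13 : ℤ) • h 1

/-- The elements forming a Chevalley-type vector space basis of a Lie algebra of type `G₂`. -/
def vectorG2 {L : Type*} [LieRing L] (h e f : Fin 2 → L) : (Fin 6 ⊕ Fin 6) ⊕ Fin 2 → L :=
  Sum.elim (Sum.elim (wordG2 e) (wordG2 f)) h

namespace IsG2Family

variable {K L : Type*} [Field K] [LieRing L] [LieAlgebra K L] {h e f : Fin 2 → L}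

section

variable (g : IsG2Family K h e f)
include g

theorem lie_regularG2_e (i : Fin 2) : ⁅regularG2 h, e i⁆ = (![1, 5] : Fin 2 → ℤ) i • e i := by
  rw [regularG2, add_lie, smul_lie, smul_lie, g.lie_h_e, g.lie_h_e, smul_smul, smul_smul,
    ← add_smul]
  congr 1
  fin_cases i <;> simp [matrixG2]

theorem lie_regularG2_f (i : Fin 2) : ⁅regularG2 h, f i⁆ = (![-1, -5] : Fin 2 → ℤ) i • f i := by
  rw [regularG2, add_lie, smul_lie, smul_lie, g.lie_h_f, g.lie_h_f, smul_smul, smul_smul,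
    ← add_smul]
  congr 1
  fin_cases i <;> simp [matrixG2]

theorem lie_regularG2_h (i : Fin 2) : ⁅regularG2 h, h i⁆ = 0 := by
  simp [regularG2, g.lie_h_h]

theorem lie_regularG2_word_e (k : Fin 6) :
    ⁅regularG2 h, wordG2 e k⁆ = valueG2 k • wordG2 e k :=
  lie_wordG2 (g.lie_regularG2_e 0) (g.lie_regularG2_e 1) k

theorem lie_regularG2_word_f (k : Fin 6) :
    ⁅regularG2 h, wordG2 f k⁆ = -valueG2 k • wordG2 f k := by
  rw [lie_wordG2 (g.lie_regularG2_f 0) (g.lie_regularG2_f 1)]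
  congr 1
  fin_cases k <;> rfl

theorem linearIndependent_vectorG2 [CharZero K] [FiniteDimensional K L] :
    LinearIndependent K (vectorG2 h e f) := by
  set T : End K L := LieModule.toEnd K L L (regularG2 h) with hT
  have hind := T.eigenspaces_iSupIndep
  have hinj : Function.Injective (Sum.elim valueG2 (-valueG2)) := by decide
  have hev (x : Fin 6 ⊕ Fin 6) : Sum.elim (wordG2 e) (wordG2 f) x ∈
      T.eigenspace ((Sum.elim valueG2 (-valueG2) x : ℤ) : K) := by
    rw [End.mem_eigenspace_iff, Int.cast_smul_eq_zsmul]
    rcases x with k | k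
    · exact g.lie_regularG2_word_e k
    · exact g.lie_regularG2_word_f k
  have hne (x : Fin 6 ⊕ Fin 6) : Sum.elim (wordG2 e) (wordG2 f) x ≠ 0 := by
    rcases x with k | k
    · exact g.wordG2_ne_zero k
    · exact g.symm.wordG2_ne_zero k
  have h1 : LinearIndependent K (Sum.elim (wordG2 e) (wordG2 f)) :=
    T.eigenvectors_linearIndependent' (fun x ↦ ((Sum.elim valueG2 (-valueG2) x : ℤ) : K))
      (Int.cast_injective.comp hinj) _ fun x ↦ ⟨hev x, hne x⟩
  refine h1.sum_type g.linInd ?_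
  refine (hind (0 : K)).symm.mono ?_ ?_
  · rw [Submodule.span_le]
    rintro _ ⟨x, rfl⟩
    have hx : ((Sum.elim valueG2 (-valueG2) x : ℤ) : K) ≠ 0 := by
      rw [Int.cast_ne_zero]
      revert x; decide
    exact Submodule.mem_iSup_of_mem _ (Submodule.mem_iSup_of_mem hx (hev x))
  · rw [Submodule.span_le]
    rintro _ ⟨i, rfl⟩
    rw [SetLike.mem_coe, End.mem_eigenspace_iff, zero_smul]
    exact g.lie_regularG2_h i

variable [CharZero K] [FiniteDimensional K L] (hL : finrank K L = 14)
include hL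

theorem span_vectorG2 : Submodule.span K (Set.range (vectorG2 h e f)) = ⊤ :=
  g.linearIndependent_vectorG2.span_eq_top_of_card_eq_finrank' (by simp [hL])

theorem mem_lieSpan (x : L) : x ∈ LieSubalgebra.lieSpan K L (Set.range e ∪ Set.range f) := by
  set S := LieSubalgebra.lieSpan K L (Set.range e ∪ Set.range f)
  have he (i) : e i ∈ S := LieSubalgebra.subset_lieSpan (Or.inl ⟨i, rfl⟩)
  have hf (i) : f i ∈ S := LieSubalgebra.subset_lieSpan (Or.inr ⟨i, rfl⟩)
  have hw (u : Fin 2 → L) (hu : ∀ i, u i ∈ S) (k : Fin 6) : wordG2 u k ∈ S := by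
    have h2 := S.lie_mem (hu 0) (hu 1)
    have h3 := S.lie_mem (hu 0) h2
    have h4 := S.lie_mem (hu 0) h3
    have h5 := S.lie_mem (hu 1) h4
    fin_cases k
    exacts [hu 0, hu 1, h2, h3, h4, h5]
  have : (⊤ : Submodule K L) ≤ S.toSubmodule := by
    rw [← g.span_vectorG2 hL, Submodule.span_le]
    rintro _ ⟨(k | k) | i, rfl⟩
    · exact hw e he k
    · exact hw f hf k
    · change h i ∈ S
      rw [← (g.sl2 i).lie_e_f]
      exact S.lie_mem (he i) (hf i)
  exact this trivial

/-- A `G₂`-family in a 14-dimensional Lie algebra generates it. -/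
@[simps h e f A]
def basis (H : LieSubalgebra K L) (hH : H.toSubmodule = Submodule.span K (Set.range h)) :
    LieAlgebra.Basis (Fin 2) H where
  A := matrixG2
  h := h
  e := e
  f := f
  cartan_eq_lieSpan := by
    refine le_antisymm ?_ ?_
    · change H.toSubmodule ≤ (LieSubalgebra.lieSpan K L (Set.range h)).toSubmodule
      rw [hH, Submodule.span_le]
      exact LieSubalgebra.subset_lieSpan
    · rw [LieSubalgebra.lieSpan_le]
      change Set.range h ⊆ H.toSubmodule
      rw [hH]
      exact Submodule.subset_span
  span_ef := eq_top_iff.mpr fun x _ ↦ g.mem_lieSpan hL x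
  linInd := g.linInd
  nondegen := by
    refine Matrix.nondegenerate_of_det_ne_zero ?_
    simp [matrixG2, Matrix.det_fin_two]
  sl2 := g.sl2
  lie_h_h := g.lie_h_h
  lie_h_e := g.lie_h_e
  lie_h_f := g.lie_h_f
  lie_e_f_ne i j hij := g.lie_e_f_ne i j hij

/-- The vector space basis attached to a `G₂`-family in a 14-dimensional Lie algebra. -/
noncomputable def vectorBasis : Module.Basis ((Fin 6 ⊕ Fin 6) ⊕ Fin 2) K L :=
  .mk g.linearIndependent_vectorG2 (g.span_vectorG2 hL).ge

theorem exists_smul_of_lie_eq {x : L} (k : Fin 6) (hx : ⁅regularG2 h, x⁆ = valueG2 k • x) :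
    ∃ c : K, x = c • wordG2 e k := by
  set b := g.vectorBasis hL
  have hb (i) : b i = vectorG2 h e f i := by simp [b, vectorBasis]
  let v : (Fin 6 ⊕ Fin 6) ⊕ Fin 2 → ℤ := Sum.elim (Sum.elim valueG2 (-valueG2)) 0
  have hv (i) : ⁅regularG2 h, b i⁆ = v i • b i := by
    rw [hb]
    rcases i with (k | k) | i
    · exact g.lie_regularG2_word_e k
    · exact g.lie_regularG2_word_f k
    · exact (g.lie_regularG2_h i).trans (zero_smul ℤ _).symm
  have h1 (i) : (v i : K) * b.repr x i = valueG2 k * b.repr x i := by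
    have h2 : ⁅regularG2 h, x⁆ = ∑ i, ((v i : K) * b.repr x i) • b i := by
      conv_lhs => rw [← b.sum_repr x]
      rw [lie_sum]
      refine Finset.sum_congr rfl fun i _ ↦ ?_
      rw [lie_smul, hv, ← Int.cast_smul_eq_zsmul K, smul_smul, mul_comm]
    have h3 := congrArg (fun y ↦ b.repr y i) (h2.symm.trans hx)
    rw [← Int.cast_smul_eq_zsmul K] at h3
    rwa [b.repr_sum_self, map_smul] at h3
  have h4 (i) (hi : i ≠ Sum.inl (Sum.inl k)) : b.repr x i = 0 := by
    have hne : v i ≠ valueG2 k := by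
      clear h1 hv hb b hx
      revert k
      revert i
      decide
    by_contra h0
    exact hne (by exact_mod_cast mul_right_cancel₀ h0 (h1 i))
  refine ⟨b.repr x (Sum.inl (Sum.inl k)), ?_⟩
  conv_lhs => rw [← b.sum_repr x]
  rw [Finset.sum_eq_single (Sum.inl (Sum.inl k)) (fun i _ hi ↦ by rw [h4 i hi, zero_smul])
    (by simp), hb]
  rfl

theorem exists_smul_e {x : L} (i : Fin 2) (hx : ∀ j, ⁅h j, x⁆ = matrixG2 i j • x) :
    ∃ c : K, x = c • e i := by
  have key : ⁅regularG2 h, x⁆ = (![1, 5] : Fin 2 → ℤ) i • x := by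
    rw [regularG2, add_lie, smul_lie, smul_lie, hx, hx, smul_smul, smul_smul, ← add_smul]
    congr 1
    fin_cases i <;> simp [matrixG2]
  fin_cases i
  · exact g.exists_smul_of_lie_eq hL 0 key
  · exact g.exists_smul_of_lie_eq hL 1 key

theorem exists_smul_f {x : L} (i : Fin 2) (hx : ∀ j, ⁅h j, x⁆ = -matrixG2 i j • x) :
    ∃ c : K, x = c • f i :=
  g.symm.exists_smul_e hL i fun j ↦ by rw [neg_lie, hx, neg_smul, neg_neg]

end
end IsG2Family
end LieAlgebra

namespace LieAlgebra.IsKilling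

variable {K L : Type*} [Field K] [CharZero K] [LieRing L] [LieAlgebra K L] [FiniteDimensional K L]
  [IsKilling K L] (H : LieSubalgebra K L) [H.IsCartanSubalgebra]
  [LieModule.IsTriangularizable K H L]

open LieModule

theorem isG2Family_of_isSl2Triple [Nontrivial L] {a : Fin 2 → H.root}
    (hp : ∀ i j, (a i : Weight K H L) (coroot (a j : Weight K H L)) = (matrixG2 i j : K))
    {h e f : Fin 2 → L} (sl2 : ∀ i, IsSl2Triple (h i) (e i) (f i))
    (he : ∀ i, e i ∈ rootSpace H (a i : Weight K H L))
    (hf : ∀ i, f i ∈ rootSpace H (-(a i : Weight K H L))) :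
    IsG2Family K h e f := by
  have hh (i) : h i = (coroot (a i : Weight K H L) : H) :=
    (sl2 i).h_eq_coroot (H.isNonZero_coe_root _) (he i) (hf i)
  refine ⟨?_, sl2, fun i j ↦ ?_, fun i j ↦ ?_, fun i j ↦ ?_, fun i j hij ↦ ?_⟩
  · have h1 : LinearIndependent K fun i ↦ coroot (a i : Weight K H L) := by
      rw [Fintype.linearIndependent_iff]
      intro c hc
      have e0 := congrArg (a 0 : Weight K H L).toLinear hc
      have e1 := congrArg (a 1 : Weight K H L).toLinear hc
      simp [Fin.sum_univ_two, hp, matrixG2] at e0 e1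
      have h0 : c 0 = 0 := by linear_combination 2 * e0 + e1
      have h1 : c 1 = 0 := by linear_combination 3 * e0 + 2 * e1
      intro i
      fin_cases i <;> assumption
    have h2 := h1.map' H.toSubmodule.subtype (Submodule.ker_subtype _)
    rw [funext hh]
    exact h2
  · rw [hh, hh, ← LieSubalgebra.coe_bracket, trivial_lie_zero, ZeroMemClass.coe_zero]
  · rw [hh, ← Int.cast_smul_eq_zsmul K, ← hp]
    exact lie_eq_smul_of_mem_rootSpace (he i) _
  · rw [hh, ← Int.cast_smul_eq_zsmul K, Int.cast_neg, ← hp]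
    exact lie_eq_smul_of_mem_rootSpace (hf i) _
  · have h5 : ∀ i j : Fin 2, i ≠ j →
        matrixG2 i 0 - matrixG2 j 0 = 5 ∨ matrixG2 i 0 - matrixG2 j 0 = -5 := by decide
    specialize h5 i j hij
    by_contra h0
    have h1 := lie_mem_genWeightSpace_of_mem_genWeightSpace (he i) (hf j)
    let γ : Weight K H L :=
      ⟨(a i : Weight K H L) + (-(a j : Weight K H L) : H → K), fun hb ↦ h0 (by simpa [hb] using h1)⟩
    have hγ : γ (coroot (a 0 : Weight K H L)) = (matrixG2 i 0 - matrixG2 j 0 : ℤ) := by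
      change (a i : Weight K H L) _ + -((a j : Weight K H L) _) = _
      rw [hp, hp]
      push_cast
      ring
    have hγ0 : γ.IsNonZero := by
      intro hz
      have : γ (coroot (a 0 : Weight K H L)) = 0 := by simp [hz.eq]
      rw [hγ, Int.cast_eq_zero] at this
      lia
    let g : H.root := ⟨γ, by simpa using hγ0⟩
    have h2 : ((rootSystem H).pairingIn ℤ g (a 0) : K) = (matrixG2 i 0 - matrixG2 j 0 : ℤ) := by
      rw [← hγ]
      exact (rootSystem H).algebraMap_pairingIn ℤ g (a 0)
    rw [Int.cast_inj] at h2
    have h3 := (rootSystem H).pairingIn_pairingIn_mem_set_of_isCrystal_of_isRed g (a 0)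
    rw [h2] at h3
    simp only [Set.mem_insert_iff, Set.mem_singleton_iff, Prod.mk.injEq] at h3
    rcases h5 with h5 | h5 <;> simp [h5] at h3

theorem exists_isG2Family [LieAlgebra.IsSimple K L] (hL : finrank K L = 14) :
    ∃ h e f : Fin 2 → L, IsG2Family K h e f ∧
      H.toSubmodule = Submodule.span K (Set.range h) := by
  have := LieAlgebra.IsSimple.nontrivial K L
  have := isG2_rootSystem H hL
  let _i : (rootSystem H).EmbeddedG2 := RootPairing.IsG2.toEmbeddedG2 _
  let a : Fin 2 → H.root := ![RootPairing.EmbeddedG2.short (rootSystem H),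
    RootPairing.EmbeddedG2.long (rootSystem H)]
  have hp (i j) : (a i : Weight K H L) (coroot (a j : Weight K H L)) = (matrixG2 i j : K) := by
    rw [← rootSystem_pairing_apply]
    fin_cases i <;> fin_cases j <;> simp [a, matrixG2, -rootSystem_pairing_apply]
  choose h e f sl2 he hf using fun i ↦
    exists_isSl2Triple_of_weight_isNonZero (H.isNonZero_coe_root (a i))
  have g := isG2Family_of_isSl2Triple H hp sl2 he hf
  refine ⟨h, e, f, g, ?_⟩
  have hH : finrank K H = 2 := by
    have h1 := finrank_eq_finrank_cartan_add_card_root H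
    have h2 := RootPairing.EmbeddedG2.card_index_eq_twelve (rootSystem H)
    rw [Nat.card_eq_finsetCard] at h2
    lia
  refine (Submodule.eq_of_le_of_finrank_eq ?_ ?_).symm
  · rw [Submodule.span_le]
    rintro _ ⟨i, rfl⟩
    rw [(sl2 i).h_eq_coroot (H.isNonZero_coe_root _) (he i) (hf i)]
    exact SetLike.coe_mem _
  · rw [finrank_span_eq_card g.linInd, Fintype.card_fin]
    exact hH.symm

end LieAlgebra.IsKilling

namespace LieAlgebra

/-- The nontrivial character of `ZMod 2` with values in a ring. -/
def signZMod2 (K : Type*) [Ring K] (z : ZMod 2) : K := if z = 0 then 1 else -1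

section signZMod2

variable {K : Type*} [Ring K]

@[simp] theorem signZMod2_zero : signZMod2 K 0 = 1 := by simp [signZMod2]

@[simp] theorem signZMod2_one : signZMod2 K 1 = -1 := by simp [signZMod2]

theorem _root_.ZMod.eq_zero_or_eq_one (x : ZMod 2) : x = 0 ∨ x = 1 := by
  revert x
  decide

theorem signZMod2_add (x y : ZMod 2) : signZMod2 K (x + y) = signZMod2 K x * signZMod2 K y := by
  have h : (1 + 1 : ZMod 2) = 0 := rfl
  obtain rfl | rfl := x.eq_zero_or_eq_one <;> obtain rfl | rfl := y.eq_zero_or_eq_one <;> simp [h]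

theorem signZMod2_mul_self (x : ZMod 2) : signZMod2 K x * signZMod2 K x = 1 := by
  obtain rfl | rfl := x.eq_zero_or_eq_one <;> simp

theorem signZMod2_injective [CharZero K] : Function.Injective (signZMod2 K) := by
  have h1 : (1 : K) ≠ -1 := by
    intro h
    have h2 : ((1 + 1 : ℕ) : K) = 0 := by
      rw [Nat.cast_add, Nat.cast_one]
      exact eq_neg_iff_add_eq_zero.mp h
    exact absurd (Nat.cast_eq_zero.mp h2) (by decide)
  intro x y hxy
  obtain rfl | rfl := x.eq_zero_or_eq_one <;> obtain rfl | rfl := y.eq_zero_or_eq_one <;>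
    simp_all [h1.symm]

theorem exists_eq_signZMod2 {K : Type*} [Field K] {x : K} (hx : x * x = 1) :
    ∃ z, x = signZMod2 K z := by
  rcases mul_self_eq_one_iff.mp hx with h | h
  · exact ⟨0, by simp [h]⟩
  · exact ⟨1, by simp [h]⟩

end signZMod2

/-- The two coefficients of the positive roots of `G₂` modulo two. -/
def parityG2 (k : Fin 6) : ZMod 2 × ZMod 2 :=
  (![1, 0, 1, 0, 1, 1] k, ![0, 1, 1, 1, 1, 0] k)

/-- The degrees of the elements `jordanVector` in the standard Jordan grading. -/
def jordanDegree : (Fin 6 ⊕ Fin 6) ⊕ Fin 2 → Fin 3 → ZMod 2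
  | .inl (.inl k) => ![(parityG2 k).1, (parityG2 k).2, 0]
  | .inl (.inr k) => ![(parityG2 k).1, (parityG2 k).2, 1]
  | .inr _ => ![0, 0, 1]

theorem card_jordanDegree_eq {s : Fin 3 → ZMod 2} (hs : s ≠ 0) :
    Fintype.card {i // jordanDegree i = s} = 2 := by
  revert s
  decide

/-- The homogeneous elements of the standard Jordan grading attached to a `G₂`-family. -/
def jordanVector {L : Type*} [LieRing L] (h e f : Fin 2 → L) : (Fin 6 ⊕ Fin 6) ⊕ Fin 2 → L :=
  Sum.elim (Sum.elim (wordG2 e + wordG2 f) (wordG2 e - wordG2 f)) h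

section

variable {K L L' : Type*} [Field K] [LieRing L] [LieAlgebra K L] [LieRing L'] [LieAlgebra K L']

theorem map_wordG2 (φ : L →ₗ⁅K⁆ L') (e : Fin 2 → L) (k : Fin 6) :
    φ (wordG2 e k) = wordG2 (fun i ↦ φ (e i)) k := by
  fin_cases k <;> simp [wordG2]

theorem wordG2_sign_smul (z : Fin 2 → ZMod 2) (e : Fin 2 → L) (k : Fin 6) :
    wordG2 (fun i ↦ signZMod2 K (z i) • e i) k =
      signZMod2 K (z 0 * (parityG2 k).1 + z 1 * (parityG2 k).2) • wordG2 e k := by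
  have h2 (x : ZMod 2) (y : L) : signZMod2 K x • signZMod2 K x • y = y := by
    rw [smul_smul, signZMod2_mul_self, one_smul]
  fin_cases k <;> simp [wordG2, parityG2, signZMod2_add, mul_smul, h2,
    smul_comm (signZMod2 K (z 1)) (signZMod2 K (z 0))]

theorem map_jordanVector (φ : L →ₗ⁅K⁆ L') (h e f : Fin 2 → L) (i : (Fin 6 ⊕ Fin 6) ⊕ Fin 2) :
    φ (jordanVector h e f i) =
      jordanVector (fun i ↦ φ (h i)) (fun i ↦ φ (e i)) (fun i ↦ φ (f i)) i := by
  rcases i with (k | k) | i <;> simp [jordanVector, map_wordG2]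

theorem map_jordanVector_of_sign {h e f : Fin 2 → L} (φ : L →ₗ⁅K⁆ L) (z : Fin 2 → ZMod 2)
    (hh : ∀ i, φ (h i) = h i) (he : ∀ i, φ (e i) = signZMod2 K (z i) • e i)
    (hf : ∀ i, φ (f i) = signZMod2 K (z i) • f i) (i : (Fin 6 ⊕ Fin 6) ⊕ Fin 2) :
    φ (jordanVector h e f i) =
      signZMod2 K (z 0 * jordanDegree i 0 + z 1 * jordanDegree i 1) • jordanVector h e f i := by
  rw [map_jordanVector]
  simp only [hh, he, hf]
  rcases i with (k | k) | i <;> simp [jordanVector, jordanDegree, wordG2_sign_smul, smul_sub]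

theorem map_jordanVector_of_swap {h e f : Fin 2 → L} (φ : L →ₗ⁅K⁆ L)
    (hh : ∀ i, φ (h i) = -h i) (he : ∀ i, φ (e i) = f i)
    (hf : ∀ i, φ (f i) = e i) (i : (Fin 6 ⊕ Fin 6) ⊕ Fin 2) :
    φ (jordanVector h e f i) = signZMod2 K (jordanDegree i 2) • jordanVector h e f i := by
  rw [map_jordanVector]
  simp only [hh, he, hf]
  rcases i with (k | k) | i <;> simp [jordanVector, jordanDegree, add_comm]

end

namespace IsG2Family

variable {K L : Type*} [Field K] [CharZero K] [LieRing L] [LieAlgebra K L] [FiniteDimensional K L]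
  {h e f : Fin 2 → L} (g : IsG2Family K h e f) (hL : finrank K L = 14)
include g hL

theorem span_jordanVector : Submodule.span K (Set.range (jordanVector h e f)) = ⊤ := by
  rw [eq_top_iff, ← g.span_vectorG2 hL, Submodule.span_le]
  set S := Submodule.span K (Set.range (jordanVector h e f))
  have hS (i) : jordanVector h e f i ∈ S := Submodule.subset_span ⟨i, rfl⟩
  have h2 : (2 : K) ≠ 0 := two_ne_zero
  rintro _ ⟨(k | k) | i, rfl⟩
  · have := S.smul_mem (2 : K)⁻¹ (S.add_mem (hS (.inl (.inl k))) (hS (.inl (.inr k))))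
    convert this using 1
    simp [vectorG2, jordanVector, ← two_smul K, h2]
  · have := S.smul_mem (2 : K)⁻¹ (S.sub_mem (hS (.inl (.inl k))) (hS (.inl (.inr k))))
    convert this using 1
    simp [vectorG2, jordanVector, ← two_smul K, h2]
  · exact hS (.inr i)

/-- The elements `jordanVector` as a basis. -/
noncomputable def jordanBasis : Module.Basis ((Fin 6 ⊕ Fin 6) ⊕ Fin 2) K L :=
  basisOfTopLeSpanOfCardEqFinrank (jordanVector h e f) (g.span_jordanVector hL).ge (by simp [hL])

@[simp]
theorem jordanBasis_apply (i) : g.jordanBasis hL i = jordanVector h e f i := by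
  simp [jordanBasis]

theorem linearIndependent_jordanVector : LinearIndependent K (jordanVector h e f) := by
  rw [← funext (g.jordanBasis_apply hL)]
  exact (g.jordanBasis hL).linearIndependent

end IsG2Family

end LieAlgebra

namespace LieAlgebra

section

variable {K L ι A : Type*} [Field K] [LieRing L] [LieAlgebra K L]

/-- The span of the elements of a family which have a given degree. -/
def degreeSpan (K : Type*) {L ι A : Type*} [Field K] [LieRing L] [LieAlgebra K L]
    (b : ι → L) (d : ι → A) (s : A) : Submodule K L :=
  Submodule.span K (b '' {i | d i = s})

theorem finrank_degreeSpan [Fintype ι] [DecidableEq A] {b : ι → L} (hb : LinearIndependent K b)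
    (d : ι → A) (s : A) : finrank K (degreeSpan K b d s) = Fintype.card {i // d i = s} := by
  rw [degreeSpan, Set.image_eq_range]
  exact finrank_span_eq_card (hb.comp _ Subtype.val_injective)

theorem isInternal_degreeSpan [DecidableEq A] (b : Module.Basis ι K L) (d : ι → A) :
    DirectSum.IsInternal (degreeSpan K b d) := by
  rw [DirectSum.isInternal_submodule_iff_iSupIndep_and_iSup_eq_top]
  refine ⟨fun s ↦ ?_, ?_⟩
  · refine (b.linearIndependent.disjoint_span_image (disjoint_compl_right
      (a := {i | d i = s}))).mono le_rfl ?_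
    refine iSup₂_le fun t ht ↦ Submodule.span_mono (Set.image_mono fun i hi ↦ ?_)
    rintro rfl
    exact ht hi.symm
  · rw [eq_top_iff, ← b.span_eq, Submodule.span_le]
    rintro _ ⟨i, rfl⟩
    exact Submodule.mem_iSup_of_mem (d i) (Submodule.subset_span ⟨i, rfl, rfl⟩)

theorem mem_degreeSpan_iff [CharZero K] {n : ℕ} (b : Module.Basis ι K L)
    (d : ι → Fin n → ZMod 2) (τ : Fin n → End K L)
    (hτ : ∀ j i, τ j (b i) = signZMod2 K (d i j) • b i) (s : Fin n → ZMod 2) (x : L) :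
    x ∈ degreeSpan K b d s ↔ ∀ j, τ j x = signZMod2 K (s j) • x := by
  constructor
  · intro hx j
    refine Submodule.span_induction ?_ (by simp) (fun x y _ _ hx hy ↦ ?_) (fun c x _ hx ↦ ?_) hx
    · rintro _ ⟨i, rfl, rfl⟩
      exact hτ j i
    · rw [map_add, hx, hy, smul_add]
    · rw [map_smul, hx, smul_comm]
  · intro hx
    rw [degreeSpan, b.mem_span_image]
    intro i hi
    ext j
    have h1 : b.repr (τ j x) i = signZMod2 K (d i j) * b.repr x i := by
      have : (Finsupp.lapply i ∘ₗ b.repr.toLinearMap ∘ₗ τ j : L →ₗ[K] K) =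
          signZMod2 K (d i j) • (Finsupp.lapply i ∘ₗ b.repr.toLinearMap) := by
        refine b.ext fun k ↦ ?_
        by_cases hk : k = i
        · subst hk; simp [hτ]
        · simp [hτ, Finsupp.single_eq_of_ne (Ne.symm hk)]
      exact LinearMap.congr_fun this x
    rw [hx j, map_smul, Finsupp.smul_apply, smul_eq_mul] at h1
    exact signZMod2_injective (mul_right_cancel₀ (Finsupp.mem_support_iff.mp hi) h1).symm

theorem isLieGrading_degreeSpan [CharZero K] {n : ℕ} (b : Module.Basis ι K L)
    (d : ι → Fin n → ZMod 2) (τ : Fin n → L →ₗ⁅K⁆ L)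
    (hτ : ∀ j i, τ j (b i) = signZMod2 K (d i j) • b i) :
    IsLieGrading K (degreeSpan K b d) := by
  refine ⟨isInternal_degreeSpan b d, fun s t x hx y hy ↦ ?_⟩
  rw [mem_degreeSpan_iff b d (fun j ↦ (τ j : End K L)) hτ] at hx hy ⊢
  intro j
  have hx' : τ j x = _ := hx j
  have hy' : τ j y = _ := hy j
  change τ j ⁅x, y⁆ = _
  rw [LieHom.map_lie, hx', hy', smul_lie, lie_smul, smul_smul, Pi.add_apply, signZMod2_add]

end

namespace IsG2Family

variable {K L : Type*} [Field K] [CharZero K] [LieRing L] [LieAlgebra K L] [FiniteDimensional K L]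
  [LieAlgebra.IsSimple K L] {h e f : Fin 2 → L}

theorem exists_lieEquiv {h' e' f' : Fin 2 → L} (g : IsG2Family K h e f) (g' : IsG2Family K h' e' f')
    (hL : finrank K L = 14)
    {H H' : LieSubalgebra K L} (hH : H.toSubmodule = Submodule.span K (Set.range h))
    (hH' : H'.toSubmodule = Submodule.span K (Set.range h')) :
    ∃ φ : L ≃ₗ⁅K⁆ L, (∀ i, φ (e i) = e' i) ∧ (∀ i, φ (f i) = f' i) ∧ (∀ i, φ (h i) = h' i) :=
  (g.basis hL H hH).exists_lieEquiv (g'.basis hL H' hH') rfl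

omit [CharZero K] [FiniteDimensional K L] [LieAlgebra.IsSimple K L] in
theorem rescale (g : IsG2Family K h e f) (t : Fin 2 → K) (ht : ∀ i, t i ≠ 0) :
    IsG2Family K h (fun i ↦ t i • e i) (fun i ↦ (t i)⁻¹ • f i) where
  linInd := g.linInd
  sl2 i :=
    { h_ne_zero := (g.sl2 i).h_ne_zero
      lie_e_f := by simp [ht i, (g.sl2 i).lie_e_f]
      lie_h_e_nsmul := by rw [lie_smul, (g.sl2 i).lie_h_e_nsmul, smul_comm]
      lie_h_f_nsmul := by rw [lie_smul, (g.sl2 i).lie_h_f_nsmul, smul_neg, smul_comm] }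
  lie_h_h := g.lie_h_h
  lie_h_e i j := by rw [lie_smul, g.lie_h_e, smul_comm]
  lie_h_f i j := by rw [lie_smul, g.lie_h_f, smul_comm]
  lie_e_f_ne i j hij := by simp [g.lie_e_f_ne i j hij]

theorem isLieGrading_jordan (g : IsG2Family K h e f) (hL : finrank K L = 14) {H : LieSubalgebra K L}
    (hH : H.toSubmodule = Submodule.span K (Set.range h)) :
    IsLieGrading K (degreeSpan K (jordanVector h e f) jordanDegree) := by
  have hsign (z : Fin 2 → ZMod 2) : ∃ φ : L ≃ₗ⁅K⁆ L, ∀ i, φ (jordanVector h e f i) =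
      signZMod2 K (z 0 * jordanDegree i 0 + z 1 * jordanDegree i 1) • jordanVector h e f i := by
    have ht (i) : signZMod2 K (z i) ≠ 0 := left_ne_zero_of_mul_eq_one (signZMod2_mul_self (z i))
    obtain ⟨φ, he, hf, hh⟩ := g.exists_lieEquiv (g.rescale _ ht) hL hH hH
    refine ⟨φ, map_jordanVector_of_sign φ.toLieHom z hh he fun i ↦ (hf i).trans ?_⟩
    rw [inv_eq_of_mul_eq_one_left (signZMod2_mul_self (z i))]
  obtain ⟨φ₀, h₀⟩ := hsign ![1, 0]
  obtain ⟨φ₁, h₁⟩ := hsign ![0, 1]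
  obtain ⟨σ, he, hf, hh⟩ := g.exists_lieEquiv g.symm hL hH (H' := H) (by
    rw [hH, ← Submodule.span_neg, ← Set.image_neg_eq_neg, ← Set.range_comp]; rfl)
  have h₂ := map_jordanVector_of_swap σ.toLieHom hh he hf
  have := isLieGrading_degreeSpan (g.jordanBasis hL) jordanDegree
    ![φ₀.toLieHom, φ₁.toLieHom, σ.toLieHom] fun j i ↦ by
      rw [jordanBasis_apply]
      fin_cases j
      · simpa using h₀ i
      · simpa using h₁ i
      · exact h₂ i
  rwa [show (g.jordanBasis hL : _ → L) = jordanVector h e f from funext (g.jordanBasis_apply hL)]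
    at this

end IsG2Family

theorem exists_jordan_grading {K L : Type*} [Field K] [CharZero K] [IsAlgClosed K] [LieRing L]
    [LieAlgebra K L] [FiniteDimensional K L] [LieAlgebra.IsSimple K L] (hL : finrank K L = 14) :
    ∃ gr : (Fin 3 → ZMod 2) → Submodule K L, IsLieGrading K gr ∧
      ∀ a : Fin 3 → ZMod 2, a ≠ 0 → finrank K (gr a) = 2 := by
  obtain ⟨x, hx⟩ := LieAlgebra.exists_isCartanSubalgebra_engel K L
  obtain ⟨h, e, f, g, hH⟩ := IsKilling.exists_isG2Family (LieSubalgebra.engel K x) hL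
  refine ⟨_, g.isLieGrading_jordan hL hH, fun a ha ↦ ?_⟩
  rw [finrank_degreeSpan (g.linearIndependent_jordanVector hL), card_jordanDegree_eq ha]

end LieAlgebra

namespace IsLieGrading

open LieAlgebra

variable {K L : Type*} [Field K] [LieRing L] [LieAlgebra K L]

theorem exists_basis_eq_degreeSpan [FiniteDimensional K L] {A : Type} [AddCommGroup A]
    [DecidableEq A] {gr : A → Submodule K L} (hgr : IsLieGrading K gr) :
    ∃ (ι : Type) (b : Module.Basis ι K L) (d : ι → A), gr = degreeSpan K b d := by
  let b := hgr.1.collectedBasis fun a ↦ Module.finBasis K (gr a)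
  refine ⟨_, b, Sigma.fst, funext fun a ↦ le_antisymm (fun x hx ↦ ?_) ?_⟩
  · rw [degreeSpan, b.mem_span_image]
    intro i hi
    by_contra hne
    exact Finsupp.mem_support_iff.mp hi (hgr.1.collectedBasis_repr_of_mem_ne _ (Ne.symm hne) hx)
  · rw [degreeSpan, Submodule.span_le]
    rintro _ ⟨i, rfl, rfl⟩
    exact hgr.1.collectedBasis_mem _ i

theorem exists_lieEquiv_sign [CharZero K] [FiniteDimensional K L] {n : ℕ}
    {gr : (Fin n → ZMod 2) → Submodule K L} (hgr : IsLieGrading K gr) :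
    ∃ τ : Fin n → L ≃ₗ⁅K⁆ L,
      ∀ s x, x ∈ gr s ↔ ∀ j, τ j x = signZMod2 K (s j) • x := by
  obtain ⟨ι, b, d, hb⟩ := hgr.exists_basis_eq_degreeSpan
  let T : Fin n → End K L := fun j ↦ b.constr K fun i ↦ signZMod2 K (d i j) • b i
  have hT (j i) : T j (b i) = signZMod2 K (d i j) • b i := b.constr_basis K _ i
  have hmem (s x) : x ∈ gr s ↔ ∀ j, T j x = signZMod2 K (s j) • x := by
    rw [hb, mem_degreeSpan_iff b d T hT]
  have hbd (i) : b i ∈ gr (d i) := (hmem _ _).2 fun j ↦ hT j i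
  have hTT (j) : T j ∘ₗ T j = LinearMap.id := b.ext fun i ↦ by
    simp [hT, smul_smul, signZMod2_mul_self]
  have hlie (j x y) : T j ⁅x, y⁆ = ⁅T j x, T j y⁆ := by
    have : (LieModule.toEnd K L L : L →ₗ[K] End K L).compr₂ (T j) =
        (LieModule.toEnd K L L : L →ₗ[K] End K L).compl₁₂ (T j) (T j) := by
      refine b.ext fun i ↦ b.ext fun k ↦ ?_
      have := (hmem _ _).1 (hgr.2 _ _ _ (hbd i) _ (hbd k)) j
      simp only [LinearMap.compr₂_apply, LinearMap.compl₁₂_apply, LieHom.coe_toLinearMap,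
        LieModule.toEnd_apply_apply, hT, this, smul_lie, lie_smul, smul_smul, Pi.add_apply,
        signZMod2_add, mul_comm]
    exact LinearMap.congr_fun₂ this x y
  exact ⟨fun j ↦
    { (LinearEquiv.ofLinearMap (T j) (T j) (hTT j) (hTT j) : L ≃ₗ[K] L) with
      map_lie' := fun {x y} ↦ hlie j x y }, hmem⟩

@[elab_as_elim]
theorem induction_on {A : Type*} [AddCommGroup A] [DecidableEq A] {gr : A → Submodule K L}
    (hgr : IsLieGrading K gr) {p : L → Prop} (x : L)
    (hp : ∀ a, ∀ x ∈ gr a, p x) (hadd : ∀ x y, p x → p y → p (x + y)) : p x := by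
  have hx : x ∈ ⨆ a, gr a := by rw [hgr.1.submodule_iSup_eq_top]; trivial
  exact Submodule.iSup_induction gr (motive := p) hx hp (hp 0 0 (zero_mem _)) hadd

end IsLieGrading

theorem aeval_mul_sub_mul_aeval {K R : Type*} [CommRing K] [Ring R] [Algebra K R] {D X Y : R}
    (hY : D * X - X * D = Y) (hDY : Commute D Y) (q : Polynomial K) :
    Polynomial.aeval D q * X - X * Polynomial.aeval D q =
      Polynomial.aeval D q.derivative * Y := by
  induction q using Polynomial.induction_on with
  | C a => simp [Algebra.commutes]
  | add q r hq hr =>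
    simp only [map_add, add_mul, mul_add, ← hq, ← hr]; abel
  | monomial k a ih =>
    rw [pow_succ, ← mul_assoc, Polynomial.derivative_mul, Polynomial.derivative_X, mul_one]
    generalize Polynomial.C a * Polynomial.X ^ k = q at ih
    rw [map_mul, map_add, map_mul, Polynomial.aeval_X]
    have e1 : D * X = Y + X * D := by rw [← hY]; abel
    rw [mul_assoc, e1, mul_add, ← mul_assoc X, ← mul_assoc _ X, add_sub_assoc, ← sub_mul, ih,
      mul_assoc _ Y, ← hDY.eq, add_mul, mul_assoc, add_comm]

theorem isNilpotent_of_aeval_mul_pow_eq_zero {K R : Type*} [Field K] [CharZero K] [Ring R]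
    [Algebra K R] {D X Y : R} (hY : D * X - X * D = Y) (hDY : Commute D Y)
    (p : Polynomial K) (hp : p ≠ 0) (m : ℕ) (h : Polynomial.aeval D p * Y ^ m = 0) :
    IsNilpotent Y := by
  induction hn : p.natDegree using Nat.strong_induction_on generalizing p m with
  | _ n ih =>
    subst hn
    by_cases h0 : p.natDegree = 0
    · rw [Polynomial.eq_C_of_natDegree_eq_zero h0] at h hp
      rw [Polynomial.aeval_C, ← Algebra.smul_def] at h
      exact ⟨m, (smul_eq_zero_iff_right (by simpa using hp)).1 h⟩
    · refine ih _ (Polynomial.natDegree_derivative_lt h0) p.derivative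
        (fun hd ↦ h0 (Polynomial.derivative_eq_zero.1 hd)) (m + (1 + m)) ?_ rfl
      have hc (q : Polynomial K) : Commute (Polynomial.aeval D q) (Y ^ m) :=
        (Algebra.commute_of_mem_adjoin_singleton_of_commute
          (Polynomial.aeval_mem_adjoin_singleton K D) hDY.symm).symm.pow_right m
      rw [pow_add, ← mul_assoc, (hc _).eq, mul_assoc, pow_add, pow_one, ← mul_assoc _ Y,
        ← aeval_mul_sub_mul_aeval hY hDY, sub_mul, mul_sub, mul_assoc X, h, mul_assoc, ← mul_assoc,
        ← (hc p).eq, h]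
      simp

/-- **Jacobson's lemma**. -/
theorem isNilpotent_of_commute_commutator {K V : Type*} [Field K] [CharZero K] [AddCommGroup V]
    [Module K V] [FiniteDimensional K V] {D X : End K V} (h : Commute D (D * X - X * D)) :
    IsNilpotent (D * X - X * D) :=
  isNilpotent_of_aeval_mul_pow_eq_zero rfl h (minpoly K D)
    (minpoly.ne_zero (Algebra.IsIntegral.isIntegral D)) 0 (by simp)

namespace IsLieGrading

open LieAlgebra

variable {K L : Type*} [Field K] [LieRing L] [LieAlgebra K L]

theorem exists_eq_sum {A : Type*} [AddCommGroup A] [DecidableEq A] [Fintype A]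
    {gr : A → Submodule K L} (hgr : IsLieGrading K gr) (x : L) :
    ∃ c : A → L, (∀ a, c a ∈ gr a) ∧ x = ∑ a, c a := by
  refine hgr.induction_on x (fun a x hx ↦ ⟨Pi.single a x, fun b ↦ ?_, by simp⟩) ?_
  · by_cases h : b = a
    · subst h; simpa using hx
    · simp [Pi.single_eq_of_ne h]
  · rintro x y ⟨c, hc, rfl⟩ ⟨d, hd, rfl⟩
    exact ⟨c + d, fun a ↦ add_mem (hc a) (hd a), by simp [Finset.sum_add_distrib]⟩

theorem _root_.ZMod.add_self_eq_zero_of_pi {n : ℕ} (a : Fin n → ZMod 2) : a + a = 0 :=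
  funext fun _ ↦ CharTwo.add_self_eq_zero _

theorem eq_bot_of_finrank_eq [FiniteDimensional K L] (hL : finrank K L = 14)
    {gr : (Fin 3 → ZMod 2) → Submodule K L} (hgr : IsLieGrading K gr)
    (h : ∀ a, a ≠ 0 → finrank K (gr a) = 2) : gr 0 = ⊥ := by
  have h1 := (LinearEquiv.ofBijective (DirectSum.coeLinearMap gr) hgr.1).finrank_eq
  rw [Module.finrank_directSum, hL, Fintype.sum_eq_add_sum_compl 0,
    Finset.sum_congr rfl fun a ha ↦ h a (by simpa using ha)] at h1
  have h2 : ∑ _i ∈ ({0} : Finset (Fin 3 → ZMod 2))ᶜ, 2 = 14 := by decide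
  rw [h2] at h1
  exact Submodule.finrank_eq_zero.1 (by omega)

variable [CharZero K] [FiniteDimensional K L] {n : ℕ} {gr : (Fin n → ZMod 2) → Submodule K L}
  (hgr : IsLieGrading K gr)

include hgr

theorem killingForm_eq_zero {a b : Fin n → ZMod 2} (hab : a ≠ b) {x y : L} (hx : x ∈ gr a)
    (hy : y ∈ gr b) : killingForm K L x y = 0 := by
  obtain ⟨τ, hτ⟩ := hgr.exists_lieEquiv_sign
  obtain ⟨j, hj⟩ := Function.ne_iff.1 hab
  have h1 : a j + b j = 1 := (ZMod.eq_zero_or_eq_one _).resolve_left fun h ↦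
    hj (CharTwo.add_eq_zero.1 h)
  have h2 := killingForm_of_equiv_apply (τ j) x y
  rw [(hτ _ _).1 hx, (hτ _ _).1 hy, map_smul, map_smul, LinearMap.smul_apply, smul_smul,
    mul_comm, ← signZMod2_add, h1, signZMod2_one, neg_one_smul, neg_eq_self] at h2
  exact h2

theorem eq_zero_of_killingForm_eq_zero [IsKilling K L] {a : Fin n → ZMod 2} {x : L}
    (hx : x ∈ gr a) (h : ∀ z ∈ gr a, killingForm K L x z = 0) : x = 0 := by
  refine (IsKilling.killingForm_nondegenerate K L).1 x fun z ↦
    hgr.induction_on z (fun b z hz ↦ ?_) fun y z hy hz ↦ by rw [map_add, hy, hz, add_zero]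
  by_cases hab : a = b
  · exact h z (hab ▸ hz)
  · exact hgr.killingForm_eq_zero hab hx hz

variable (h0 : gr 0 = ⊥)

include h0

omit [CharZero K] [FiniteDimensional K L] in
theorem lie_eq_zero {a : Fin n → ZMod 2} {x y : L} (hx : x ∈ gr a) (hy : y ∈ gr a) :
    ⁅x, y⁆ = 0 := by
  have := hgr.2 a a x hx y hy
  rwa [ZMod.add_self_eq_zero_of_pi, h0, Submodule.mem_bot] at this

theorem lie_eq_zero_of_lie_lie_eq_zero_of_mem [IsKilling K L] {a b : Fin n → ZMod 2} {t x : L}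
    (ht : t ∈ gr a) (hx : x ∈ gr b) (h : ⁅t, ⁅t, x⁆⁆ = 0) : ⁅t, x⁆ = 0 := by
  have hy := hgr.2 a b t ht x hx
  refine hgr.eq_zero_of_killingForm_eq_zero hy fun z hz ↦ ?_
  have had : ad K L t * ad K L x - ad K L x * ad K L t = ad K L ⁅t, x⁆ := by
    ext z; exact (lie_lie t x z).symm
  have hcomm {u v : L} (huv : ⁅u, v⁆ = 0) : Commute (ad K L u) (ad K L v) := by
    refine LinearMap.ext fun z ↦ ?_
    have := leibniz_lie u v z
    rwa [huv, zero_lie, zero_add] at this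
  have hnil : IsNilpotent (ad K L ⁅t, x⁆) := by
    rw [← had]
    apply isNilpotent_of_commute_commutator
    rw [had]
    exact hcomm h
  rw [killingForm_apply_apply]
  exact (LinearMap.isNilpotent_trace_of_isNilpotent
    ((hcomm (hgr.lie_eq_zero h0 hy hz)).isNilpotent_mul_right hnil)).eq_zero

theorem lie_eq_zero_of_lie_lie_eq_zero [IsKilling K L] {a : Fin n → ZMod 2} {t x : L}
    (ht : t ∈ gr a) (h : ⁅t, ⁅t, x⁆⁆ = 0) : ⁅t, x⁆ = 0 := by
  obtain ⟨c, hc, rfl⟩ := hgr.exists_eq_sum x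
  simp only [lie_sum] at h ⊢
  refine Finset.sum_eq_zero fun b hb ↦ hgr.lie_eq_zero_of_lie_lie_eq_zero_of_mem h0 ht (hc b) ?_
  refine (iSupIndep_iff_finsetSum_eq_zero_imp_eq_zero gr).1 hgr.1.submodule_iSupIndep _ _
    (fun b _ ↦ ?_) h b hb
  have := hgr.2 _ _ _ ht _ (hgr.2 _ _ _ ht _ (hc b))
  rwa [← add_assoc, ZMod.add_self_eq_zero_of_pi, zero_add] at this
end IsLieGrading

namespace LieAlgebra

theorem exists_isCartanSubalgebra_of_le {K L : Type*} [Field K] [Infinite K] [LieRing L]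
    [LieAlgebra K L] [FiniteDimensional K L] (S : Submodule K L)
    (hS : ∀ x ∈ S, ∀ y ∈ S, ⁅x, y⁆ = 0)
    (h : ∀ t ∈ S, ∀ x : L, ⁅t, ⁅t, x⁆⁆ = 0 → ⁅t, x⁆ = 0) :
    ∃ H : LieSubalgebra K L, H.IsCartanSubalgebra ∧ S ≤ H.toSubmodule := by
  let C : LieSubalgebra K L :=
    { carrier := {x | ∀ t ∈ S, ⁅t, x⁆ = 0}
      add_mem' := fun hx hy t ht ↦ by rw [lie_add, hx t ht, hy t ht, add_zero]
      zero_mem' := fun t _ ↦ lie_zero t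
      smul_mem' := fun c x hx t ht ↦ by rw [lie_smul, hx t ht, smul_zero]
      lie_mem' := fun {x y} hx hy t ht ↦ by
        rw [leibniz_lie, hx t ht, hy t ht, zero_lie, lie_zero, add_zero] }
  obtain ⟨u, hu⟩ := exists_isCartanSubalgebra_engel K C
  set H' := LieSubalgebra.engel K u
  let H : LieSubalgebra K L := (C.incl.comp H'.incl).range
  have hmem (x : L) : x ∈ H ↔ ∃ hx : x ∈ C, (⟨x, hx⟩ : C) ∈ H' := by
    rw [LieHom.mem_range]
    exact ⟨by rintro ⟨y, rfl⟩; exact ⟨y.1.2, y.2⟩, fun ⟨hx, hx'⟩ ↦ ⟨⟨⟨x, hx⟩, hx'⟩, rfl⟩⟩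
  have hSH : S ≤ H.toSubmodule := fun t ht ↦ by
    refine (hmem t).2 ⟨fun s hs ↦ hS s hs t ht, ?_⟩
    rw [← hu.self_normalizing, LieSubalgebra.mem_normalizer_iff]
    intro y _
    have : ⁅(⟨t, fun s hs ↦ hS s hs t ht⟩ : C), y⁆ = 0 := Subtype.ext (y.2 t ht)
    rw [this]
    exact zero_mem _
  refine ⟨H, ⟨(C.incl.comp H'.incl).isNilpotent_range, le_antisymm (fun x hx ↦ ?_)
    H.le_normalizer⟩, hSH⟩
  rw [LieSubalgebra.mem_normalizer_iff'] at hx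
  have hxC : x ∈ C := fun t ht ↦ h t ht x (((hmem _).1 (hx t (hSH ht))).1 t ht)
  refine (hmem x).2 ⟨hxC, ?_⟩
  rw [← hu.self_normalizing, LieSubalgebra.mem_normalizer_iff']
  exact fun y hy ↦ ((hmem _).1 (hx y ((hmem _).2 ⟨y.2, hy⟩))).2

end LieAlgebra

namespace IsLieGrading

open LieAlgebra

variable {K L : Type*} [Field K] [CharZero K] [IsAlgClosed K] [LieRing L] [LieAlgebra K L]
  [FiniteDimensional K L] [LieAlgebra.IsSimple K L] (hL : finrank K L = 14)

include hL

theorem exists_isG2Family_span_eq {n : ℕ} {gr : (Fin n → ZMod 2) → Submodule K L}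
    (hgr : IsLieGrading K gr) (h0 : gr 0 = ⊥) {a : Fin n → ZMod 2} (ha : finrank K (gr a) = 2) :
    ∃ (H : LieSubalgebra K L) (h e f : Fin 2 → L), IsG2Family K h e f ∧
      H.toSubmodule = Submodule.span K (Set.range h) ∧ gr a = Submodule.span K (Set.range h) := by
  obtain ⟨H, hH, hle⟩ := exists_isCartanSubalgebra_of_le (gr a)
    (fun x hx y hy ↦ hgr.lie_eq_zero h0 hx hy)
    fun t ht x hx ↦ hgr.lie_eq_zero_of_lie_lie_eq_zero h0 ht hx
  obtain ⟨h, e, f, g, hspan⟩ := IsKilling.exists_isG2Family H hL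
  refine ⟨H, h, e, f, g, hspan, ?_⟩
  rw [← hspan]
  refine Submodule.eq_of_le_of_finrank_eq hle ?_
  rw [ha, hspan, finrank_span_eq_card g.linInd, Fintype.card_fin]

theorem exists_isG2Family_jordan {gr : (Fin 3 → ZMod 2) → Submodule K L}
    (hgr : IsLieGrading K gr) (hdim : ∀ a, a ≠ 0 → finrank K (gr a) = 2) :
    ∃ (H : LieSubalgebra K L) (h e f : Fin 2 → L) (D : (Fin 3 → ZMod 2) → (Fin 3 → ZMod 2)),
      IsG2Family K h e f ∧ H.toSubmodule = Submodule.span K (Set.range h) ∧ D 0 = 0 ∧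
      ∀ i, jordanVector h e f i ∈ gr (D (jordanDegree i)) := by
  have h0 := hgr.eq_bot_of_finrank_eq hL hdim
  obtain ⟨H, h, e, f, g, hH, ha⟩ := hgr.exists_isG2Family_span_eq hL h0
    (hdim ![0, 0, 1] (by decide))
  obtain ⟨τ, hτ⟩ := hgr.exists_lieEquiv_sign
  have hh (i) : h i ∈ gr ![0, 0, 1] := ha ▸ Submodule.subset_span ⟨i, rfl⟩
  have hh0 (i) : τ 0 (h i) = h i := by simpa using (hτ _ _).1 (hh i) 0
  have hh1 (i) : τ 1 (h i) = h i := by simpa using (hτ _ _).1 (hh i) 1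
  have hh2 (i) : τ 2 (h i) = -h i := by simpa using (hτ _ _).1 (hh i) 2
  have hττ (j x) : τ j (τ j x) = x :=
    hgr.induction_on x (fun a x hx ↦ by
      rw [(hτ _ _).1 hx, map_smul, (hτ _ _).1 hx, smul_smul, signZMod2_mul_self, one_smul])
      fun x y hx hy ↦ by simp only [map_add, hx, hy]
  have hcomm (j k x) : τ j (τ k x) = τ k (τ j x) :=
    hgr.induction_on x (fun a x hx ↦ by
      rw [(hτ _ _).1 hx, (hτ _ _).1 hx, map_smul, map_smul, (hτ _ _).1 hx, (hτ _ _).1 hx,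
        smul_comm])
      fun x y hx hy ↦ by simp only [map_add, hx, hy]
  have hswap (i) : ∃ t : K, t ≠ 0 ∧ τ 2 (t • e i) = t⁻¹ • f i := by
    obtain ⟨c, hc⟩ := g.exists_smul_f hL i (x := τ 2 (e i)) fun j ↦ by
      have := congrArg (τ 2) (g.lie_h_e i j)
      rw [LieEquiv.map_lie, hh2, map_zsmul, neg_lie] at this
      rw [neg_smul, ← this, neg_neg]
    have hc0 : c ≠ 0 := by
      rintro rfl
      rw [zero_smul] at hc
      exact (g.sl2 i).e_ne_zero ((τ 2).injective (hc.trans (map_zero _).symm))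
    obtain ⟨t, ht⟩ := IsAlgClosed.exists_eq_mul_self c⁻¹
    have ht0 : t ≠ 0 := by
      rintro rfl
      exact hc0 (by simpa using ht)
    refine ⟨t, ht0, ?_⟩
    rw [map_smul, hc, smul_smul, eq_inv_of_mul_eq_one_left (a := t * c) (b := t)]
    rw [mul_right_comm, ← ht, inv_mul_cancel₀ hc0]
  choose t ht hswap using hswap
  have g' := g.rescale t ht
  set e' : Fin 2 → L := fun i ↦ t i • e i with he'
  set f' : Fin 2 → L := fun i ↦ (t i)⁻¹ • f i with hf'
  have hsign (j) (hj : ∀ i, τ j (h i) = h i) (i) :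
      ∃ z : ZMod 2, τ j (e' i) = signZMod2 K z • e' i := by
    obtain ⟨c, hc⟩ := g'.exists_smul_e hL i (x := τ j (e' i)) fun k ↦ by
      have := congrArg (τ j) (g'.lie_h_e i k)
      rwa [LieEquiv.map_lie, hj, map_zsmul] at this
    obtain ⟨z, rfl⟩ := exists_eq_signZMod2 (K := K) (x := c) (by
      have := hττ j (e' i)
      rw [hc, map_smul, hc, smul_smul] at this
      exact smul_left_injective K (g'.sl2 i).e_ne_zero (this.trans (one_smul K _).symm))
    exact ⟨z, hc⟩
  choose z₀ hz₀ using hsign 0 hh0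
  choose z₁ hz₁ using hsign 1 hh1
  have hf {j} {z : Fin 2 → ZMod 2} (hz : ∀ i, τ j (e' i) = signZMod2 K (z i) • e' i) (i) :
      τ j (f' i) = signZMod2 K (z i) • f' i := by
    have hi : f' i = τ 2 (e' i) := (hswap i).symm
    rw [hi, hcomm, hz, map_smul]
  refine ⟨H, h, e', f', fun s ↦ ![z₀ 0 * s 0 + z₀ 1 * s 1, z₁ 0 * s 0 + z₁ 1 * s 1, s 2], g', hH,
    by ext j; fin_cases j <;> simp, fun i ↦ (hτ _ _).2 fun j ↦ ?_⟩
  fin_cases j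
  · exact map_jordanVector_of_sign (τ 0).toLieHom z₀ hh0 hz₀ (hf hz₀) i
  · exact map_jordanVector_of_sign (τ 1).toLieHom z₁ hh1 hz₁ (hf hz₁) i
  · exact map_jordanVector_of_swap (τ 2).toLieHom hh2 hswap (fun i ↦ by
      exact (congrArg (τ 2) (hswap i)).symm.trans (hττ 2 (e' i))) i

omit [IsAlgClosed K] [LieAlgebra.IsSimple K L] in
theorem degreeSpan_eq {gr : (Fin 3 → ZMod 2) → Submodule K L} (h0 : gr 0 = ⊥)
    (hdim : ∀ a, a ≠ 0 → finrank K (gr a) = 2) {h e f : Fin 2 → L} (g : IsG2Family K h e f)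
    {D : (Fin 3 → ZMod 2) → (Fin 3 → ZMod 2)}
    (hD : ∀ i, jordanVector h e f i ∈ gr (D (jordanDegree i))) {s : Fin 3 → ZMod 2}
    (hs : s ≠ 0) : degreeSpan K (jordanVector h e f) jordanDegree s = gr (D s) := by
  have hle : degreeSpan K (jordanVector h e f) jordanDegree s ≤ gr (D s) := by
    rw [degreeSpan, Submodule.span_le]
    rintro _ ⟨i, rfl, rfl⟩
    exact hD i
  have hfin : finrank K (degreeSpan K (jordanVector h e f) jordanDegree s) = 2 := by
    rw [finrank_degreeSpan (g.linearIndependent_jordanVector hL), card_jordanDegree_eq hs]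
  refine Submodule.eq_of_le_of_finrank_eq hle (hfin.trans (hdim _ fun hDs ↦ ?_).symm)
  rw [hDs, h0, le_bot_iff] at hle
  rw [hle, finrank_bot] at hfin
  omega

omit [IsAlgClosed K] [LieAlgebra.IsSimple K L] in
theorem exists_degree_eq {gr : (Fin 3 → ZMod 2) → Submodule K L} (hgr : IsLieGrading K gr)
    {h e f : Fin 2 → L} (g : IsG2Family K h e f)
    {D : (Fin 3 → ZMod 2) → (Fin 3 → ZMod 2)}
    (hD : ∀ i, jordanVector h e f i ∈ gr (D (jordanDegree i))) {b : Fin 3 → ZMod 2}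
    (hb : gr b ≠ ⊥) : ∃ s, D s = b := by
  by_contra! hne
  have htop : (⊤ : Submodule K L) ≤ ⨆ (c) (_ : c ≠ b), gr c := by
    rw [← g.span_jordanVector hL, Submodule.span_le]
    rintro _ ⟨i, rfl⟩
    exact Submodule.mem_iSup_of_mem _ (Submodule.mem_iSup_of_mem (hne _) (hD i))
  exact hb ((hgr.1.submodule_iSupIndep b).eq_bot_of_le (le_top.trans htop))

theorem gradingsEquiv {gr gr' : (Fin 3 → ZMod 2) → Submodule K L}
    (hgr : IsLieGrading K gr) (hdim : ∀ a, a ≠ 0 → finrank K (gr a) = 2)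
    (hgr' : IsLieGrading K gr') (hdim' : ∀ a, a ≠ 0 → finrank K (gr' a) = 2) :
    GradingsEquiv K gr gr' := by
  have h0 := hgr.eq_bot_of_finrank_eq hL hdim
  have h0' := hgr'.eq_bot_of_finrank_eq hL hdim'
  obtain ⟨H, h, e, f, D, g, hH, hD0, hD⟩ := hgr.exists_isG2Family_jordan hL hdim
  obtain ⟨H', h', e', f', D', g', hH', -, hD'⟩ := hgr'.exists_isG2Family_jordan hL hdim'
  obtain ⟨φ, he, hf, hh⟩ := g.exists_lieEquiv g' hL hH hH'
  refine ⟨φ, fun a ha ↦ ?_⟩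
  obtain ⟨s, rfl⟩ := exists_degree_eq hL hgr g hD ha
  have hs : s ≠ 0 := by
    rintro rfl
    exact ha (by rw [hD0, h0])
  refine ⟨D' s, ?_⟩
  rw [← degreeSpan_eq hL h0 hdim g hD hs, ← degreeSpan_eq hL h0' hdim' g' hD' hs, degreeSpan,
    Submodule.map_span, ← Set.image_comp, degreeSpan]
  congr 2
  funext i
  refine (map_jordanVector φ.toLieHom h e f i).trans ?_
  congr 1 <;> funext i
  exacts [hh i, he i, hf i]

end IsLieGrading

theorem jordan_grading_G2 (F : Type*) [Field F] [IsAlgClosed F] [CharZero F]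
    (L : Type*) [LieRing L] [LieAlgebra F L] [FiniteDimensional F L]
    [LieAlgebra.IsSimple F L] (hdim : finrank F L = 14) :
    (∃ gr : (Fin 3 → ZMod 2) → Submodule F L, IsLieGrading F gr ∧
      ∀ a : Fin 3 → ZMod 2, a ≠ 0 → finrank F (gr a) = 2) ∧
    ∀ gr gr' : (Fin 3 → ZMod 2) → Submodule F L,
      IsLieGrading F gr → (∀ a : Fin 3 → ZMod 2, a ≠ 0 → finrank F (gr a) = 2) →
      IsLieGrading F gr' → (∀ a : Fin 3 → ZMod 2, a ≠ 0 → finrank F (gr' a) = 2) →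
      GradingsEquiv F gr gr' := by
  exact ⟨LieAlgebra.exists_jordan_grading hdim,
    fun _ _ hgr h hgr' h' ↦ hgr.gradingsEquiv hdim h hgr' h'⟩
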